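/- Asymmetric tautologies and set-blocked clauses are incomparable: there exist a formula F and a clause C such that C is an asymmetric tautology in F but not set-blocked in F, and there exist a formula F and a clause C such that C is set-blocked in F but not an asymmetric tautology in F. -/

import Mathlib

abbrev Var := ℕ
abbrev Lit := Var × Bool
abbrev Clause := Finset Lit
abbrev Formula := Set Clause

def Lit.compl (l : Lit) : Lit := (l.1, !l.2)

def Clause.isTaut (C : Clause) : Prop := ∃ l ∈ C, Lit.compl l ∈ C

abbrev Assign := Var → Bool

def litSat (τ : Assign) (l : Lit) : Prop := τ l.1 = l.2
def clauseSat (τ : Assign) (C : Clause) : Prop := ∃ l ∈ C, litSat τ l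
def formulaSat (τ : Assign) (F : Formula) : Prop := ∀ C ∈ F, clauseSat τ C
def satisfiable (F : Formula) : Prop := ∃ τ : Assign, formulaSat τ F
def satEquiv (F G : Formula) : Prop := satisfiable F ↔ satisfiable G
def redundant (F : Formula) (C : Clause) : Prop := satEquiv (F \ {C}) (F ∪ {C})

def env (F : Formula) (C : Clause) : Formula := {D ∈ F | ∃ l ∈ D, Lit.compl l ∈ C}
def clauseVars (C : Clause) : Set Var := {v | ∃ l ∈ C, l.1 = v}
def formulaVars (F : Formula) : Set Var := {v | ∃ D ∈ F, ∃ l ∈ D, l.1 = v}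
def extVars (F : Formula) (C : Clause) : Set Var := formulaVars (env F C) \ clauseVars C

def semBlocked (F : Formula) (C : Clause) : Prop :=
  ∀ τ : Assign, formulaSat τ (env F C) →
    ∃ τ' : Assign, formulaSat τ' (env F C ∪ {C}) ∧ ∀ v : Var, v ∉ clauseVars C → τ v = τ' v

def blocksLit (F : Formula) (C : Clause) (l : Lit) : Prop :=
  l ∈ C ∧ ∀ D ∈ F, Lit.compl l ∈ D → Clause.isTaut (C ∪ D.erase (Lit.compl l))
def litBlocked (F : Formula) (C : Clause) : Prop := ∃ l : Lit, blocksLit F C l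

def complSet (L : Finset Lit) : Finset Lit := L.image Lit.compl
def blocksSet (F : Formula) (C : Clause) (L : Finset Lit) : Prop :=
  L.Nonempty ∧ L ⊆ C ∧
    ∀ D ∈ F, (D ∩ complSet L).Nonempty → Clause.isTaut ((C \ L) ∪ complSet L ∪ D)
def setBlocked (F : Formula) (C : Clause) : Prop := ∃ L : Finset Lit, blocksSet F C L

abbrev PAssign := Var → Option Bool
def pdom (σ : PAssign) : Set Var := {v | σ v ≠ none}
def plitSat (σ : PAssign) (l : Lit) : Prop := σ l.1 = some l.2
def pclauseSat (σ : PAssign) (C : Clause) : Prop := ∃ l ∈ C, plitSat σ l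
def pformulaSat (σ : PAssign) (F : Formula) : Prop := ∀ C ∈ F, pclauseSat σ C
def restrictF (F : Formula) (σ : PAssign) : Formula := {D ∈ F | ¬ pclauseSat σ D}
def punion (σ₁ σ₂ : PAssign) : PAssign := fun v => (σ₁ v).orElse (fun _ => σ₂ v)

def superBlocked (F : Formula) (C : Clause) : Prop :=
  ∀ σ : PAssign, pdom σ = extVars F C → setBlocked (restrictF F σ) C

def litClauses (F : Formula) (l : Lit) : Formula := {D ∈ F | l ∈ D}
def resolvents (F : Formula) (x : Var) : Formula :=
  {R | ∃ C ∈ litClauses F (x, true), ∃ D ∈ litClauses F (x, false),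
    R = C.erase (x, true) ∪ D.erase (x, false) ∧ ¬ Clause.isTaut R}
def elimVar (F : Formula) (x : Var) : Formula :=
  (F \ (litClauses F (x, true) ∪ litClauses F (x, false))) ∪ resolvents F x

def asymLit (F : Formula) (C : Clause) (l : Lit) : Prop :=
  ∃ D : Clause, D ⊆ C ∧ insert (Lit.compl l) D ∈ F \ {C}
def asymTaut (F : Formula) (C : Clause) : Prop :=
  ∃ ls : List Lit, Clause.isTaut (C ∪ ls.toFinset) ∧
    ∀ i : Fin ls.length, asymLit F (C ∪ (ls.take i.val).toFinset) (ls.get i)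
def ratPair (F : Formula) (C : Clause) : Prop :=
  asymTaut F C ∨
    ∃ l ∈ C, ∀ D ∈ F, Lit.compl l ∈ D → asymTaut F (C ∪ D.erase (Lit.compl l))

theorem asymTaut_empty {C : Clause} (h : asymTaut ∅ C) : C.isTaut := by
  obtain ⟨ls, htaut, hls⟩ := h
  cases ls with
  | nil => simpa using htaut
  | cons l ls =>
    obtain ⟨D, -, hD⟩ := hls ⟨0, by simp⟩
    exact hD.1.elim

theorem setBlocked_empty {C : Clause} (hC : C.Nonempty) : setBlocked ∅ C :=
  ⟨C, hC, subset_rfl, fun _ hD => hD.elim⟩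

theorem not_setBlocked_singleton {F : Formula} {l : Lit} (hF : {Lit.compl l} ∈ F) :
    ¬ setBlocked F {l} := by
  rintro ⟨L, hne, hsub, hL⟩
  obtain rfl := hne.subset_singleton_iff.1 hsub
  simpa [complSet, Clause.isTaut, Lit.compl, Prod.ext_iff] using hL _ hF (by simp [complSet])

theorem asymTaut_setBlocked_incomparable :
    (∃ (F : Formula) (C : Clause), asymTaut F C ∧ ¬ setBlocked F C) ∧
    (∃ (F : Formula) (C : Clause), setBlocked F C ∧ ¬ asymTaut F C) := by
  constructor
  · refine ⟨{{(1, false), (0, true)}, {(1, true)}, {(0, false)}}, {(0, true)},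
      ⟨[(1, true), (1, false)], ⟨(1, true), by simp, by simp [Lit.compl]⟩, fun i => ?_⟩,
      not_setBlocked_singleton (by simp [Lit.compl])⟩
    fin_cases i
    · exact ⟨{(0, true)}, by simp, by simp [Lit.compl], by simp; decide⟩
    · exact ⟨∅, by simp, by simp [Lit.compl], by simp; decide⟩
  · refine ⟨∅, {(0, true)}, setBlocked_empty (by simp), fun h => ?_⟩
    simpa [Clause.isTaut, Lit.compl] using asymTaut_empty h
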